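/- There exists an operator g : Y × K → Y with the following properties. (1) Input regularity: for every y ∈ Y, the map x ↦ g(y, x) is globally Lipschitz on K. (2) Freezing: for every x ∈ 𝒰 and every y ∈ Y, g(y, x) = y. (3) Convergence: for every x ∈ K \ 𝒰 and every initialization y₀ ∈ Y \ Σ°(x), the iteration y_{t+1} = g(y_t, x) converges to P_{y₀}(x) ∈ F(x); moreover Σ°(x) has m-dimensional Lebesgue measure zero in Y, so convergence holds for Lebesgue-almost every initialization y₀ ∈ Y. (4) Attractor completeness: for every x ∈ K \ 𝒰, the set of limits { lim_{t→∞} y_t(x; y₀) : y₀ ∈ Y \ Σ°(x) } equals F(x). -/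

import Mathlib

open Filter Topology MeasureTheory Set Metric Bornology RealInnerProductSpace
open scoped ENNReal NNReal

noncomputable section

namespace Bif

abbrev Xs (d : ℕ) : Type := EuclideanSpace ℝ (Fin d)
abbrev Ys (m : ℕ) : Type := EuclideanSpace ℝ (Fin m)
abbrev Zs (m d : ℕ) : Type := WithLp 2 (Ys m × Xs d)

variable {d m n : ℕ}

/-- The point `(y, x)` in `Y × ℝ^d` equipped with the product Euclidean (ℓ²) norm. -/
def ptYX (y : Ys m) (x : Xs d) : Zs m d := (WithLp.equiv 2 (Ys m × Xs d)).symm (y, x)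

def projY (p : Zs m d) : Ys m := ((WithLp.equiv 2 (Ys m × Xs d)) p).1

def projX (p : Zs m d) : Xs d := ((WithLp.equiv 2 (Ys m × Xs d)) p).2

/-- `f` is locally Lipschitz on `s`: every point of `s` has a relative
neighborhood on which `f` is Lipschitz. -/
def LocLipOn {α β : Type*} [PseudoEMetricSpace α] [PseudoEMetricSpace β]
    (s : Set α) (f : α → β) : Prop :=
  ∀ x ∈ s, ∃ C : NNReal, ∃ t ∈ 𝓝[s] x, LipschitzOnWith C f t

/-- The solution set `F(x) = {f_1(x), …, f_n(x)}`. -/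
def Fset (f : Fin n → Xs d → Ys m) (x : Xs d) : Set (Ys m) :=
  Set.range fun i => f i x

/-- The reduced Voronoi switching set `Σ°(x)`. -/
def Sigma0 (f : Fin n → Xs d → Ys m) (x : Xs d) : Set (Ys m) :=
  {y | ∃ i j : Fin n, f i x ≠ f j x ∧ ‖y - f i x‖ = ‖y - f j x‖ ∧
        ∀ k, ‖y - f i x‖ ≤ ‖y - f k x‖}

/-- The graph-closure switching set `Σ̃(x₀)`: the graph of `Σ̃` is the closure of
the graph of `Σ°` (over base points in `K`). -/
def SigmaTilde (K : Set (Xs d)) (f : Fin n → Xs d → Ys m) (x0 : Xs d) : Set (Ys m) :=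
  {y | (x0, y) ∈ closure {p : Xs d × Ys m | p.1 ∈ K ∧ p.2 ∈ Sigma0 f p.1}}

/-- `x₀` has a stable collapse pattern: on a relative neighborhood `U ⊆ K` of `x₀`
there is a partition (equivalence relation) of the branch indices such that two
branches agree at a point of `U` iff they lie in the same cluster. -/
def StableAt (K : Set (Xs d)) (f : Fin n → Xs d → Ys m) (x0 : Xs d) : Prop :=
  ∃ U ∈ 𝓝[K] x0, U ⊆ K ∧ ∃ R : Fin n → Fin n → Prop, Equivalence R ∧
    ∀ x ∈ U, ∀ i j : Fin n, (f i x = f j x ↔ R i j)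

/-- The unstable collapse set `𝒰 = K \ S`. -/
def Unstable (K : Set (Xs d)) (f : Fin n → Xs d → Ys m) : Set (Xs d) :=
  {x ∈ K | ¬ StableAt K f x}

/-- `P` is the priority nearest selector: `P y x = f i x` where `i` is the
smallest index minimizing `‖y - f i x‖`. -/
def IsPrioritySelector (f : Fin n → Xs d → Ys m) (P : Ys m → Xs d → Ys m) : Prop :=
  ∀ (y : Ys m) (x : Xs d), ∃ i : Fin n, P y x = f i x ∧
    (∀ j, ‖y - f i x‖ ≤ ‖y - f j x‖) ∧
    (∀ j, (∀ k, ‖y - f j x‖ ≤ ‖y - f k x‖) → i ≤ j)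

/-- On `closure K \ K`, `f` takes the value of the limit of `f` along `K` when this
limit exists, and `0` otherwise (limit-or-zero extension of the branch maps). -/
def IsLimitExtension (K : Set (Xs d)) (f : Fin n → Xs d → Ys m) : Prop :=
  ∀ i : Fin n, ∀ x ∈ closure K \ K,
    Tendsto (f i) (𝓝[K] x) (𝓝 (f i x)) ∨
    ((¬ ∃ L : Ys m, Tendsto (f i) (𝓝[K] x) (𝓝 L)) ∧ f i x = 0)

/-- `𝒟`: the points of `closure K` at which some (extended) branch fails to be
locally Lipschitz. -/
def DSet (K : Set (Xs d)) (f : Fin n → Xs d → Ys m) : Set (Xs d) :=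
  {x ∈ closure K | ∃ i : Fin n,
    ¬ ∃ C : NNReal, ∃ t ∈ 𝓝[closure K] x, LipschitzOnWith C (f i) t}

/-- The joint bad set `ℬ ⊆ Y × closure K`. -/
def BadSet (K : Set (Xs d)) (f : Fin n → Xs d → Ys m) : Set (Zs m d) :=
  {p | projX p ∈ DSet K f ∪ closure (Unstable K f) ∨ projY p ∈ SigmaTilde K f (projX p)}

/-- `ρ(y, x) = dist((y, x), ℬ)` in the product Euclidean norm. -/
def rhoB (K : Set (Xs d)) (f : Fin n → Xs d → Ys m) (y : Ys m) (x : Xs d) : ℝ :=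
  Metric.infDist (ptYX y x) (BadSet K f)

/-- `ω(y, x) = ρ(y, x) / (1 + ρ(y, x))`. -/
def omegaB (K : Set (Xs d)) (f : Fin n → Xs d → Ys m) (y : Ys m) (x : Xs d) : ℝ :=
  rhoB K f y x / (1 + rhoB K f y x)

/-- The safe tube `𝒮(R, s)`. -/
def STube (K : Set (Xs d)) (f : Fin n → Xs d → Ys m) (R s : ℝ) : Set (Ys m × Xs d) :=
  {q | q.2 ∈ closure K ∧ ‖q.1‖ ≤ R ∧ s ≤ omegaB K f q.1 q.2}

/-- The set whose supremum is the safe-set profile `H₁(R, s)`. -/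
def H1set (K : Set (Xs d)) (f : Fin n → Xs d → Ys m) (P : Ys m → Xs d → Ys m)
    (R s : ℝ) : Set ℝ :=
  {r | ∃ y x z, (y, x) ∈ STube K f R s ∧ (y, z) ∈ STube K f R s ∧ x ≠ z ∧
       r = ‖P y x - P y z‖ / ‖x - z‖}

/-- The set whose supremum is the safe-set profile `H₂(R, s)`. -/
def H2set (K : Set (Xs d)) (f : Fin n → Xs d → Ys m) (P : Ys m → Xs d → Ys m)
    (R s : ℝ) : Set ℝ :=
  {r | ∃ y x, (y, x) ∈ STube K f R s ∧ r = ‖P y x‖}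

def H1 (K : Set (Xs d)) (f : Fin n → Xs d → Ys m) (P : Ys m → Xs d → Ys m) (R s : ℝ) : ℝ :=
  sSup (H1set K f P R s)

def H2 (K : Set (Xs d)) (f : Fin n → Xs d → Ys m) (P : Ys m → Xs d → Ys m) (R s : ℝ) : ℝ :=
  sSup (H2set K f P R s)

/-- `λ_R(s) = 1 / (H₁(R, s) + H₂(R, s) + 1)`. -/
def lamB (K : Set (Xs d)) (f : Fin n → Xs d → Ys m) (P : Ys m → Xs d → Ys m)
    (R s : ℝ) : ℝ :=
  1 / (H1 K f P R s + H2 K f P R s + 1)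

/-- `Θ_R(r) = ∫₀^r λ_R(s) ds`. -/
def ThetaB (K : Set (Xs d)) (f : Fin n → Xs d → Ys m) (P : Ys m → Xs d → Ys m)
    (R r : ℝ) : ℝ :=
  ∫ s in (0:ℝ)..r, lamB K f P R s

/-- The damping factor `η(y, x)`. -/
def etaB (K : Set (Xs d)) (f : Fin n → Xs d → Ys m) (P : Ys m → Xs d → Ys m)
    (y : Ys m) (x : Xs d) : ℝ :=
  ThetaB K f P (1 + ‖y‖) (omegaB K f y x) /
    (1 + ThetaB K f P (1 + ‖y‖) (omegaB K f y x))

/-- The recurrent operator `g(y, x) = (1 − η(y, x)) y + η(y, x) P_y(x)`. -/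
def gB (K : Set (Xs d)) (f : Fin n → Xs d → Ys m) (P : Ys m → Xs d → Ys m)
    (y : Ys m) (x : Xs d) : Ys m :=
  (1 - etaB K f P y x) • y + etaB K f P y x • P y x

/-- Local quality of the selector at scale `r`. -/
def Qg (K : Set (Xs d)) (f : Fin n → Xs d → Ys m) (P : Ys m → Xs d → Ys m)
    (y0 : Ys m) (x0 : Xs d) (r : ℝ) : Prop :=
  0 < r ∧ r ≤ 1 ∧ ∀ y, dist y y0 < r → ∀ x ∈ K, dist x x0 < r →
    x ∉ Unstable K f ∧ r * ‖P y x - y‖ ≤ 1 ∧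
      ∀ z ∈ K, dist z x0 < r → r * ‖P y x - P y z‖ ≤ dist x z

def rhoQ (K : Set (Xs d)) (f : Fin n → Xs d → Ys m) (P : Ys m → Xs d → Ys m)
    (y : Ys m) (x : Xs d) : ℝ := sSup {r | r = 0 ∨ Qg K f P y x r}

section helpers
variable {K : Set (Xs d)} {f : Fin n → Xs d → Ys m} {P : Ys m → Xs d → Ys m}

lemma Qg.shift {y y' : Ys m} {x x' : Xs d} {r s : ℝ} (h : Qg K f P y x r) (hs : 0 < s)
    (h1 : dist y' y + s ≤ r) (h2 : dist x' x + s ≤ r) : Qg K f P y' x' s := by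
  obtain ⟨h0, h1', H⟩ := h
  have hsr : s ≤ r := by linarith [dist_nonneg (x := x') (y := x)]
  refine ⟨hs, by linarith, fun w hw z hz hzx => ?_⟩
  have a1 : dist w y < r := by linarith [dist_triangle w y' y]
  have a2 : dist z x < r := by linarith [dist_triangle z x' x]
  obtain ⟨b1, b2, b3⟩ := H w a1 z hz a2
  refine ⟨b1, le_trans (by gcongr) b2, fun v hv hvx => ?_⟩
  exact le_trans (by gcongr) (b3 v hv (by linarith [dist_triangle v x' x]))

lemma rho_bdd (y : Ys m) (x : Xs d) : BddAbove {r | r = 0 ∨ Qg K f P y x r} := by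
  refine ⟨1, ?_⟩
  rintro r (rfl | h)
  · norm_num
  · exact h.2.1

lemma rho_nonneg (y : Ys m) (x : Xs d) : 0 ≤ rhoQ K f P y x :=
  le_csSup (rho_bdd y x) (Or.inl rfl)

lemma rho_le_one (y : Ys m) (x : Xs d) : rhoQ K f P y x ≤ 1 := by
  refine csSup_le ⟨0, Or.inl rfl⟩ ?_
  rintro r (rfl | h)
  · norm_num
  · exact h.2.1

lemma le_rho {y : Ys m} {x : Xs d} {r : ℝ} (h : Qg K f P y x r) : r ≤ rhoQ K f P y x :=
  le_csSup (rho_bdd y x) (Or.inr h)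

lemma Qg_of_lt {y : Ys m} {x : Xs d} {r : ℝ} (h0 : 0 < r) (h : r < rhoQ K f P y x) :
    Qg K f P y x r := by
  obtain ⟨s, hs, hrs⟩ := exists_lt_of_lt_csSup
    (s := {r | r = 0 ∨ Qg K f P y x r}) ⟨0, Or.inl rfl⟩ h
  rcases hs with rfl | hs
  · linarith
  · exact hs.shift h0 (by simpa using hrs.le) (by simpa using hrs.le)

lemma rho_lip (y y' : Ys m) (x x' : Xs d) :
    rhoQ K f P y x - max (dist y' y) (dist x' x) ≤ rhoQ K f P y' x' := by
  by_contra! hlt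
  set D := max (dist y' y) (dist x' x) with hD
  have hD0 : 0 ≤ D := le_max_of_le_left dist_nonneg
  have h0 := rho_nonneg (K := K) (f := f) (P := P) y' x'
  obtain ⟨s, hs1, hs2⟩ := exists_between hlt
  have hq : Qg K f P y x (s + D) := Qg_of_lt (by linarith) (by linarith)
  have := le_rho (hq.shift (y' := y') (x' := x') (s := s) (by linarith)
    (by linarith [le_max_left (dist y' y) (dist x' x)])
    (by linarith [le_max_right (dist y' y) (dist x' x)]))
  linarith

lemma lim_aux {a e N B : ℝ} (h : e < a) (H : ∀ r, e < r → r < a → r * N ≤ B) : a * N ≤ B := by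
  have ht : Tendsto (fun r : ℝ => r * N) (𝓝[<] a) (𝓝 (a * N)) :=
    (Continuous.tendsto (by fun_prop) a).mono_left nhdsWithin_le_nhds
  refine le_of_tendsto ht ?_
  filter_upwards [Ioo_mem_nhdsLT h] with r hr using H r hr.1 hr.2

lemma rho_bound {y : Ys m} {x z : Xs d} (hz : z ∈ K)
    (h : dist z x < rhoQ K f P y x) : rhoQ K f P y x * ‖P y z - y‖ ≤ 1 := by
  refine lim_aux h fun r h1 h2 => ?_
  have hr : 0 < r := dist_nonneg.trans_lt h1
  exact ((Qg_of_lt hr h2).2.2 y (by simpa using hr) z hz h1).2.1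

lemma rho_bound' {y : Ys m} {x : Xs d} (hx : x ∈ K) :
    rhoQ K f P y x * ‖P y x - y‖ ≤ 1 := by
  rcases (rho_nonneg (K := K) (f := f) (P := P) y x).eq_or_lt with h | h
  · rw [← h]; norm_num
  · exact rho_bound hx (by simpa using h)

lemma rho_diff {y : Ys m} {x z : Xs d} (hx : x ∈ K) (hz : z ∈ K)
    (h : dist z x < rhoQ K f P y x) :
    rhoQ K f P y x * ‖P y x - P y z‖ ≤ dist x z := by
  refine lim_aux h fun r h1 h2 => ?_
  have hr : 0 < r := dist_nonneg.trans_lt h1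
  exact ((Qg_of_lt hr h2).2.2 y (by simpa using hr) x hx (by simpa using hr)).2.2 z hz h1

def gQ (K : Set (Xs d)) (f : Fin n → Xs d → Ys m) (P : Ys m → Xs d → Ys m)
    (y : Ys m) (x : Xs d) : Ys m := y + (rhoQ K f P y x) ^ 2 • (P y x - y)

lemma g_lip_aux {y : Ys m} {x z : Xs d} (hx : x ∈ K) (hz : z ∈ K)
    (hab : rhoQ K f P y z ≤ rhoQ K f P y x) :
    dist (gQ K f P y x) (gQ K f P y z) ≤ 3 * dist x z := by
  have hb0 := rho_nonneg (K := K) (f := f) (P := P) y z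
  have ha1 := rho_le_one (K := K) (f := f) (P := P) y x
  have hl := rho_lip (K := K) (f := f) (P := P) y y x z
  have hbx := rho_bound' (f := f) (P := P) (y := y) hx
  have hbz := rho_bound' (f := f) (P := P) (y := y) hz
  have hd := rho_diff (f := f) (P := P) (y := y) hx hz
  have hB := rho_bound (f := f) (P := P) (y := y) (x := x) hz
  rw [dist_self, max_eq_right dist_nonneg, dist_comm z x] at hl
  rw [dist_comm z x] at hd hB
  unfold gQ
  rw [dist_add_left, dist_eq_norm]
  set a := rhoQ K f P y x
  set b := rhoQ K f P y z
  have hD : 0 ≤ dist x z := dist_nonneg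
  have ha0 : 0 ≤ a := hb0.trans hab
  by_cases hc : dist x z < a
  · specialize hd hc
    specialize hB hc
    have e : a ^ 2 • (P y x - y) - b ^ 2 • (P y z - y)
        = a ^ 2 • (P y x - P y z) + (a ^ 2 - b ^ 2) • (P y z - y) := by module
    have hab2 : 0 ≤ a ^ 2 - b ^ 2 := by nlinarith
    rw [e]
    refine (norm_add_le _ _).trans ?_
    rw [norm_smul, norm_smul, Real.norm_of_nonneg (sq_nonneg a), Real.norm_of_nonneg hab2]
    have t1 : a ^ 2 * ‖P y x - P y z‖ ≤ dist x z := by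
      have : a * (a * ‖P y x - P y z‖) ≤ 1 * dist x z := by gcongr
      linarith
    have t2 : (a ^ 2 - b ^ 2) * ‖P y z - y‖ ≤ 2 * dist x z := by
      have h1 : a ^ 2 - b ^ 2 ≤ dist x z * (2 * a) := by nlinarith
      calc _ ≤ dist x z * (2 * a) * ‖P y z - y‖ := by gcongr
        _ = 2 * dist x z * (a * ‖P y z - y‖) := by ring
        _ ≤ 2 * dist x z * 1 := by gcongr
        _ = _ := by ring
    linarith
  · push Not at hc
    refine (norm_sub_le _ _).trans ?_
    rw [norm_smul, norm_smul, Real.norm_of_nonneg (sq_nonneg a),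
      Real.norm_of_nonneg (sq_nonneg b)]
    have t1 : a * (a * ‖P y x - y‖) ≤ a * 1 := by gcongr
    have t2 : b * (b * ‖P y z - y‖) ≤ b * 1 := by gcongr
    nlinarith

lemma g_lip (y : Ys m) : LipschitzOnWith 3 (fun x => gQ K f P y x) K := by
  refine LipschitzOnWith.of_dist_le_mul fun x hx z hz => ?_
  rcases le_total (rhoQ K f P y z) (rhoQ K f P y x) with h | h
  · simpa using g_lip_aux hx hz h
  · have := g_lip_aux hz hx h
    rw [dist_comm, dist_comm z x] at this
    simpa using this

lemma rho_unstable {y : Ys m} {x : Xs d} (hx : x ∈ Unstable K f) : rhoQ K f P y x = 0 := by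
  refine le_antisymm (csSup_le ⟨0, Or.inl rfl⟩ ?_) (rho_nonneg y x)
  rintro r (rfl | h)
  · exact le_rfl
  · exact absurd hx (h.2.2 y (by simpa using h.1) x hx.1 (by simpa using h.1)).1

lemma rho_pos (hf : ∀ i, LocLipOn K (f i)) (hP : IsPrioritySelector f P)
    {x : Xs d} (hx : x ∈ K \ Unstable K f) {y : Ys m} (hy : y ∉ Sigma0 f x) :
    0 < rhoQ K f P y x := by
  obtain ⟨hxK, hxU⟩ := hx
  have hst : StableAt K f x := by
    by_contra h
    exact hxU ⟨hxK, h⟩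
  obtain ⟨U, hU, hUK, R, hR, hUR⟩ := hst
  obtain ⟨i, hi, hmin, -⟩ := hP y x
  have hcont : ∀ j, Tendsto (f j) (𝓝[K] x) (𝓝 (f j x)) := by
    intro j
    obtain ⟨C, t, ht, hL⟩ := hf j x hxK
    have hxt : x ∈ t := mem_of_mem_nhdsWithin hxK ht
    have : ContinuousWithinAt (f j) t x := hL.continuousOn x hxt
    exact this.tendsto.mono_left (nhdsWithin_le_iff.2 ht)
  have hxU' : x ∈ U := mem_of_mem_nhdsWithin hxK hU
  have hN : ∀ j, Tendsto (fun p : Ys m × Xs d => ‖p.1 - f j p.2‖) (𝓝 y ×ˢ 𝓝[K] x)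
      (𝓝 ‖y - f j x‖) := fun j =>
    (tendsto_fst.sub ((hcont j).comp tendsto_snd)).norm
  have hev1 : ∀ j, ∀ᶠ p : Ys m × Xs d in 𝓝 y ×ˢ 𝓝[K] x,
      f j p.2 = f i p.2 ∨ ‖p.1 - f i p.2‖ < ‖p.1 - f j p.2‖ := by
    intro j
    by_cases hj : f j x = f i x
    · have : ∀ᶠ p : Ys m × Xs d in 𝓝 y ×ˢ 𝓝[K] x, p.2 ∈ U := tendsto_snd.eventually hU
      filter_upwards [this] with p hp
      exact Or.inl ((hUR _ hp j i).2 ((hUR _ hxU' j i).1 hj))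
    · have hlt : ‖y - f i x‖ < ‖y - f j x‖ := by
        refine lt_of_le_of_ne (hmin j) fun h => hy ⟨i, j, fun h' => hj h'.symm, h, hmin⟩
      filter_upwards [(hN i).eventually_lt (hN j) hlt] with p hp using Or.inr hp
  have hev2 : ∀ᶠ p : Ys m × Xs d in 𝓝 y ×ˢ 𝓝[K] x, ‖p.1 - f i p.2‖ < ‖y - f i x‖ + 1 :=
    (hN i).eventually (gt_mem_nhds (by linarith))
  obtain ⟨C, t, ht, hL⟩ := hf i x hxK
  have hev3 : ∀ᶠ p : Ys m × Xs d in 𝓝 y ×ˢ 𝓝[K] x, p.2 ∈ t := tendsto_snd.eventually ht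
  have hev4 : ∀ᶠ p : Ys m × Xs d in 𝓝 y ×ˢ 𝓝[K] x, p.2 ∉ Unstable K f := by
    have : ∀ᶠ x' in 𝓝[K] x, ∀ᶠ z in 𝓝[K] x', z ∈ U := eventually_eventually_nhdsWithin.2 hU
    filter_upwards [tendsto_snd.eventually this] with p hp hpU
    exact hpU.2 ⟨U, hp, hUK, R, hR, hUR⟩
  have hall := (((eventually_all.2 hev1).and hev2).and hev3).and hev4
  obtain ⟨A, hA, B, hB, hAB⟩ := eventually_prod_iff.1 hall
  obtain ⟨r1, hr1, hr1A⟩ := Metric.eventually_nhds_iff.1 hA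
  obtain ⟨r2, hr2, hr2B⟩ := Metric.mem_nhdsWithin_iff.1 hB
  have hM : 0 < ‖y - f i x‖ + 1 := by positivity
  set M := ‖y - f i x‖ + 1
  obtain ⟨r, hr0, hr⟩ : ∃ r : ℝ, 0 < r ∧ r ≤ min (min r1 r2) (min 1 (min (1 / M) (1 / (C + 1)))) :=
    ⟨_, by positivity, le_rfl⟩
  simp only [le_min_iff] at hr
  obtain ⟨⟨hrr1, hrr2⟩, hr1', hrM, hrC⟩ := hr
  have key : ∀ y', dist y' y < r → ∀ x' ∈ K, dist x' x < r →
      P y' x' = f i x' ∧ ‖y' - f i x'‖ < M ∧ x' ∈ t ∧ x' ∉ Unstable K f := by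
    intro y' hy' x' hx' hxx
    obtain ⟨⟨⟨h1, h2⟩, h3⟩, h4⟩ := hAB (hr1A (hy'.trans_le hrr1))
      (hr2B (show x' ∈ _ from ⟨hxx.trans_le hrr2, hx'⟩))
    obtain ⟨k, hk, hkm, -⟩ := hP y' x'
    refine ⟨?_, h2, h3, h4⟩
    rcases h1 k with h | h
    · rw [hk]; exact h
    · exact absurd (hkm i) (not_le.2 h)
  refine hr0.trans_le (le_rho ⟨hr0, hr1', fun y' hy' x' hx' hxx => ?_⟩)
  obtain ⟨k1, k2, k3, k4⟩ := key y' hy' x' hx' hxx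
  refine ⟨k4, ?_, fun z hz hzx => ?_⟩
  · rw [k1, norm_sub_rev]
    calc r * ‖y' - f i x'‖ ≤ 1 / M * M := by gcongr
      _ = 1 := by field_simp
  · obtain ⟨l1, l2, l3, l4⟩ := key y' hy' z hz hzx
    rw [k1, l1, ← dist_eq_norm]
    have := hL.dist_le_mul x' k3 z l3
    have hC : (0:ℝ) ≤ C := C.2
    calc r * dist (f i x') (f i z) ≤ 1 / (C + 1) * (C * dist x' z) := by gcongr
      _ = (C / (C + 1)) * dist x' z := by ring
      _ ≤ 1 * dist x' z := by
        gcongr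
        rw [div_le_one (by positivity)]
        linarith
      _ = _ := one_mul _

lemma cell (hP : IsPrioritySelector f P) {x : Xs d} {y : Ys m} (hy : y ∉ Sigma0 f x)
    {c : ℝ} (h0 : 0 ≤ c) (h1 : c ≤ 1) :
    P (P y x + c • (y - P y x)) x = P y x ∧ P y x + c • (y - P y x) ∉ Sigma0 f x := by
  obtain ⟨i, hi, hmin, -⟩ := hP y x
  rw [hi]
  have hlt : ∀ j, f j x ≠ f i x →
      ‖f i x + c • (y - f i x) - f i x‖ < ‖f i x + c • (y - f i x) - f j x‖ := by
    intro j hj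
    have hl : ‖y - f i x‖ < ‖y - f j x‖ :=
      lt_of_le_of_ne (hmin j) fun h => hy ⟨i, j, fun h' => hj h'.symm, h, hmin⟩
    have e : y - f j x = (f i x + c • (y - f i x) - f j x) + (1 - c) • (y - f i x) := by module
    have t := norm_add_le (f i x + c • (y - f i x) - f j x) ((1 - c) • (y - f i x))
    rw [← e, norm_smul, Real.norm_of_nonneg (by linarith : 0 ≤ 1 - c)] at t
    rw [add_sub_cancel_left, norm_smul, Real.norm_of_nonneg h0]
    linarith
  have hu : ∀ k, (∀ l, ‖f i x + c • (y - f i x) - f k x‖ ≤ ‖f i x + c • (y - f i x) - f l x‖) →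
      f k x = f i x := by
    intro k hk
    by_contra h
    exact absurd (hk i) (not_le.2 (hlt k h))
  constructor
  · obtain ⟨k, hk, hkm, -⟩ := hP (f i x + c • (y - f i x)) x
    rw [hk]
    exact hu k hkm
  · rintro ⟨a, b, hab, heq, hm⟩
    exact hab ((hu a hm).trans (hu b (heq ▸ hm)).symm)

lemma converge (hf : ∀ i, LocLipOn K (f i)) (hP : IsPrioritySelector f P)
    {x : Xs d} (hx : x ∈ K \ Unstable K f) {y : Ys m} (hy : y ∉ Sigma0 f x) :
    Tendsto (fun t : ℕ => (fun y => gQ K f P y x)^[t] y) atTop (𝓝 (P y x)) := by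
  set p := P y x with hp
  have hcr : Continuous fun w : Ys m => rhoQ K f P w x := by
    refine LipschitzWith.continuous (K := 1) (LipschitzWith.of_dist_le_mul fun w w' => ?_)
    have h1 := rho_lip (K := K) (f := f) (P := P) w w' x x
    have h2 := rho_lip (K := K) (f := f) (P := P) w' w x x
    rw [dist_self, max_eq_left dist_nonneg] at h1 h2
    rw [dist_comm] at h1
    rw [Real.dist_eq, abs_le]
    simp only [NNReal.coe_one, one_mul]
    constructor <;> linarith
  have hcc : Continuous fun c : ℝ => rhoQ K f P (p + c • (y - p)) x :=
    hcr.comp (by fun_prop)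
  obtain ⟨c0, hc0, hmin⟩ := (isCompact_Icc (a := (0:ℝ)) (b := 1)).exists_isMinOn
    ⟨0, by simp⟩ hcc.continuousOn
  set δ := rhoQ K f P (p + c0 • (y - p)) x with hδ
  have hδ0 : 0 < δ := rho_pos hf hP hx (cell hP hy hc0.1 hc0.2).2
  have hδ1 : δ ≤ 1 := rho_le_one _ _
  have hq0 : 0 ≤ 1 - δ ^ 2 := by nlinarith
  have main : ∀ t : ℕ, ∃ c : ℝ, 0 ≤ c ∧ c ≤ (1 - δ ^ 2) ^ t ∧
      (fun y => gQ K f P y x)^[t] y = p + c • (y - p) := by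
    intro t
    induction t with
    | zero => exact ⟨1, by norm_num, by simp, by simp⟩
    | succ t ih =>
      obtain ⟨c, h0, h1, h2⟩ := ih
      have hc1 : c ≤ 1 := h1.trans (pow_le_one₀ hq0 (by nlinarith))
      rw [Function.iterate_succ_apply', h2]
      have hge : δ ≤ rhoQ K f P (p + c • (y - p)) x := hmin ⟨h0, hc1⟩
      have hle := rho_le_one (K := K) (f := f) (P := P) (p + c • (y - p)) x
      have hPc : P (p + c • (y - p)) x = p := (cell hP hy h0 hc1).1
      simp only [gQ]
      rw [hPc]
      set s := rhoQ K f P (p + c • (y - p)) x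
      refine ⟨(1 - s ^ 2) * c, mul_nonneg (by nlinarith) h0, ?_, by module⟩
      rw [pow_succ (1 - δ ^ 2) t, mul_comm ((1 - δ ^ 2) ^ t)]
      gcongr
  choose c h0 h1 h2 using main
  have hc : Tendsto c atTop (𝓝 0) :=
    squeeze_zero h0 h1 (tendsto_pow_atTop_nhds_zero_of_lt_one hq0 (by nlinarith))
  have : Tendsto (fun t => p + c t • (y - p)) atTop (𝓝 (p + (0:ℝ) • (y - p))) :=
    tendsto_const_nhds.add (hc.smul_const _)
  simp only [h2]
  simpa using this

lemma sigma_null (f : Fin n → Xs d → Ys m) (x : Xs d) : volume (Sigma0 f x) = 0 := by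
  have hsub : Sigma0 f x ⊆ ⋃ i, ⋃ j, ⋃ _ : f i x ≠ f j x,
      (AffineSubspace.perpBisector (f i x) (f j x) : Set (Ys m)) := by
    rintro y ⟨i, j, hij, he, -⟩
    simp only [mem_iUnion]
    refine ⟨i, j, hij, ?_⟩
    rw [SetLike.mem_coe, AffineSubspace.mem_perpBisector_iff_dist_eq, dist_eq_norm, dist_eq_norm]
    exact he
  refine measure_mono_null hsub ?_
  refine measure_iUnion_null fun i => measure_iUnion_null fun j => measure_iUnion_null fun h => ?_
  refine Measure.addHaar_affineSubspace _ _ ?_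
  rw [Ne, AffineSubspace.perpBisector_eq_top]
  exact h

end helpers

/-- Existence of a regular weight-tied operator representing the
set-valued map: input regularity, freezing on the unstable collapse set,
convergence to `P_{y₀}(x) ∈ F(x)` for every initialization outside the null set
`Σ°(x)`, and attractor completeness. -/
theorem statement0 {d m n : ℕ}
    (K : Set (Xs d)) (hK : IsBounded K)
    (f : Fin n → Xs d → Ys m) (hf : ∀ i, LocLipOn K (f i))
    (P : Ys m → Xs d → Ys m) (hP : IsPrioritySelector f P) :
    ∃ g : Ys m → Xs d → Ys m,
      -- (1) input regularity: x ↦ g(y, x) is globally Lipschitz on K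
      (∀ y : Ys m, ∃ C : NNReal, LipschitzOnWith C (fun x => g y x) K) ∧
      -- (2) freezing on the unstable collapse set 𝒰
      (∀ x ∈ Unstable K f, ∀ y : Ys m, g y x = y) ∧
      -- (3) convergence: for x ∈ K \ 𝒰 and y₀ ∉ Σ°(x), the iterates converge to
      -- P_{y₀}(x) ∈ F(x); moreover Σ°(x) has Lebesgue measure zero
      (∀ x ∈ K \ Unstable K f,
        (∀ y0 : Ys m, y0 ∉ Sigma0 f x →
          Tendsto (fun t : ℕ => (fun y => g y x)^[t] y0) atTop (𝓝 (P y0 x)) ∧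
          P y0 x ∈ Fset f x) ∧
        volume (Sigma0 f x) = 0) ∧
      -- (4) attractor completeness
      (∀ x ∈ K \ Unstable K f,
        {u : Ys m | ∃ y0 : Ys m, y0 ∉ Sigma0 f x ∧
            Tendsto (fun t : ℕ => (fun y => g y x)^[t] y0) atTop (𝓝 u)} = Fset f x) := by
  have hPF : ∀ y x, P y x ∈ Fset f x := by
    intro y x
    obtain ⟨i, hi, -⟩ := hP y x
    exact ⟨i, hi.symm⟩
  refine ⟨gQ K f P, fun y => ⟨3, g_lip y⟩, fun x hx y => ?_, fun x hx =>
    ⟨fun y0 hy0 => ⟨converge hf hP hx hy0, hPF _ _⟩, sigma_null f x⟩, fun x hx => ?_⟩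
  · simp [gQ, rho_unstable hx]
  · ext u
    constructor
    · rintro ⟨y0, hy0, ht⟩
      rw [tendsto_nhds_unique ht (converge hf hP hx hy0)]
      exact hPF _ _
    · rintro ⟨i, rfl⟩
      have hm : ∀ k, (∀ l, ‖f i x - f k x‖ ≤ ‖f i x - f l x‖) → f k x = f i x := by
        intro k hk
        have := hk i
        rw [sub_self, norm_zero] at this
        exact (sub_eq_zero.1 (norm_le_zero_iff.1 this)).symm
      have hS : f i x ∉ Sigma0 f x := by
        rintro ⟨a, b, hab, he, hmin⟩
        exact hab ((hm a hmin).trans (hm b (he ▸ hmin)).symm)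
      refine ⟨f i x, hS, ?_⟩
      have hc := converge hf hP hx hS
      obtain ⟨k, hk, hkm, -⟩ := hP (f i x) x
      rwa [hk, hm k hkm] at hc

end Bif
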